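/- arXiv:2303.17713 — 2 statements merged into one kernel-verified Lean document; each statement's English description precedes it below -/
import Mathlib

section
/- (Theorem 1, labeling functions can be arbitrarily unfair; in-probability form.) Let θ₀ ≥ 0, c ∈ ℝ^d, and let (μ_k) be a sequence of Borel probability measures on ℝ^d such that for every M > 0, μ_k({x : ‖x − c‖ ≤ M}) → 0 as k → ∞. Then the expected labeling-function accuracy ∫ σ(2θ₀/(1 + ‖x − c‖)) dμ_k(x) converges to 1/2 (random guessing) as k → ∞. -/
open MeasureTheory Filter

/-- The logistic sigmoid function. -/
noncomputable def sigmoid (u : ℝ) : ℝ := 1 / (1 + Real.exp (-u))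

theorem continuous_logisticSigmoid : Continuous sigmoid := by
  unfold sigmoid
  refine continuous_const.div (by fun_prop) fun u => ?_
  positivity

theorem abs_sigmoid_sub_half_le_one (u : ℝ) : |sigmoid u - 1 / 2| ≤ 1 := by
  have hpos : 0 < sigmoid u := by unfold sigmoid; positivity
  have hle : sigmoid u ≤ 1 := by
    unfold sigmoid
    rw [div_le_one (by positivity)]
    linarith [Real.exp_pos (-u)]
  rw [abs_le]
  constructor <;> linarith

/-- If a function is uniformly close to `a` off sets whose mass vanishes along the sequence of
probability measures, and is bounded, then its integrals converge to `a`. -/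
theorem tendsto_integral_of_tendsto_measure_zero {X : Type*} [MeasurableSpace X]
    {μ : ℕ → Measure X} (hμ : ∀ k, IsProbabilityMeasure (μ k)) {g : X → ℝ} {a C : ℝ}
    (hg : Measurable g) (hC : ∀ x, |g x - a| ≤ C)
    (h : ∀ ε > 0, ∃ S, MeasurableSet S ∧ Tendsto (fun k => μ k S) atTop (nhds 0) ∧
      ∀ x ∉ S, |g x - a| ≤ ε) :
    Tendsto (fun k => ∫ x, g x ∂(μ k)) atTop (nhds a) := by
  rw [Metric.tendsto_atTop']
  intro ε hε
  obtain ⟨S, hS, hlim, hclose⟩ := h (ε / 2) (by positivity)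
  have hlim' : Tendsto (fun k => ε / 2 + (μ k).real S * C) atTop (nhds (ε / 2 + 0 * C)) :=
    (((ENNReal.tendsto_toReal ENNReal.zero_ne_top).comp hlim).mul_const C).const_add _
  have hev := hlim'.eventually (gt_mem_nhds (show ε / 2 + 0 * C < ε by linarith))
  obtain ⟨N, hN⟩ := eventually_atTop.1 hev
  refine ⟨N, fun k hk => lt_of_le_of_lt ?_ (hN k hk.le)⟩
  have := hμ k
  have hsub : Integrable (fun x => g x - a) (μ k) :=
    Integrable.of_bound (hg.sub_const a).aestronglyMeasurable C (ae_of_all _ hC)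
  have hint : Integrable g (μ k) := by
    simpa [Pi.add_def] using hsub.add (integrable_const a)
  have hind : Integrable (S.indicator fun _ => C) (μ k) := (integrable_const C).indicator hS
  calc dist (∫ x, g x ∂(μ k)) a = |∫ x, (g x - a) ∂(μ k)| := by
        rw [integral_sub hint (integrable_const a)]
        simp [Real.dist_eq]
    _ ≤ ∫ x, |g x - a| ∂(μ k) := abs_integral_le_integral_abs
    _ ≤ ∫ x, (ε / 2 + S.indicator (fun _ => C) x) ∂(μ k) := by
        refine integral_mono hsub.abs ((integrable_const _).add hind) fun x => ?_
        by_cases hx : x ∈ S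
        · simp only [Set.indicator_of_mem hx]
          linarith [hC x]
        · simpa only [Set.indicator_of_notMem hx, add_zero] using hclose x hx
    _ = ε / 2 + (μ k).real S * C := by
        rw [integral_add (integrable_const _) hind, integral_indicator_const C hS]
        simp

/-- Theorem 1 (in-probability form): if the probability measures `μ_k` on `ℝ^d` put
vanishing mass on every ball around the center `c`, then the expected
labeling-function accuracy `∫ σ(2θ₀/(1 + ‖x - c‖)) dμ_k` converges to `1/2`
(random guessing). -/
theorem stmt8 {d : ℕ} (θ₀ : ℝ) (hθ : 0 ≤ θ₀) (c : EuclideanSpace ℝ (Fin d))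
    (μ : ℕ → Measure (EuclideanSpace ℝ (Fin d))) (hμ : ∀ k, IsProbabilityMeasure (μ k))
    (h : ∀ M : ℝ, 0 < M →
      Tendsto (fun k => μ k {x | ‖x - c‖ ≤ M}) atTop (nhds 0)) :
    Tendsto (fun k => ∫ x, sigmoid (2 * θ₀ / (1 + ‖x - c‖)) ∂(μ k)) atTop
      (nhds (1 / 2)) := by
  have hcont : Continuous fun x : EuclideanSpace ℝ (Fin d) =>
      sigmoid (2 * θ₀ / (1 + ‖x - c‖)) := by
    refine continuous_logisticSigmoid.comp
      (continuous_const.div (continuous_const.add (continuous_id.sub continuous_const).norm)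
        fun x => ?_)
    positivity
  refine tendsto_integral_of_tendsto_measure_zero hμ hcont.measurable
    (fun x => abs_sigmoid_sub_half_le_one _) fun ε hε => ?_
  have hlim : Tendsto (fun r : ℝ => sigmoid (2 * θ₀ / (1 + r))) atTop (nhds (1 / 2)) := by
    have h0 : sigmoid 0 = 1 / 2 := by norm_num [sigmoid]
    rw [← h0]
    exact (continuous_logisticSigmoid.tendsto 0).comp
      ((tendsto_atTop_add_const_left _ 1 tendsto_id).const_div_atTop _)
  obtain ⟨N, hN⟩ := Metric.tendsto_atTop.1 hlim ε hε
  refine ⟨{x | ‖x - c‖ ≤ max N 1}, ?_, h _ (by positivity), fun x hx => ?_⟩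
  · exact measurableSet_le (by fun_prop) measurable_const
  · exact (hN _ ((le_max_left N 1).trans (not_le.1 hx).le)).le
end

section
/- (Correctness of the linear optimal transport map between covariance matrices.) Let Σ_s and Σ_t be symmetric positive definite real d×d matrices, and define A = Σ_s^{−1/2} · (Σ_s^{1/2} · Σ_t · Σ_s^{1/2})^{1/2} · Σ_s^{−1/2}, where M^{1/2} denotes the unique positive semidefinite square root of a positive semidefinite matrix M and Σ_s^{−1/2} is the inverse of Σ_s^{1/2}. Then A is symmetric positive definite and satisfies A · Σ_s · Aᵀ = A · Σ_s · A = Σ_t. -/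
open Matrix

/-- Correctness of the linear optimal transport (Knott–Smith) map between covariance
matrices: if `S` is the (unique) positive semidefinite square root of the positive
definite matrix `Σ_s` (here `Sigs`), `R` is the positive semidefinite square root of
`S * Σ_t * S` (with `Σ_t = Sigt`), and `A = S⁻¹ * R * S⁻¹`, then `A` is symmetric
positive definite and `A * Σ_s * Aᵀ = A * Σ_s * A = Σ_t`. -/
theorem stmt15 {d : ℕ} (Sigs Sigt S R A : Matrix (Fin d) (Fin d) ℝ)
    (hSigs : Sigs.PosDef) (hSigt : Sigt.PosDef)
    (hS : S.PosSemidef) (hS2 : S * S = Sigs)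
    (hR : R.PosSemidef) (hR2 : R * R = S * Sigt * S)
    (hA : A = S⁻¹ * R * S⁻¹) :
    A.PosDef ∧ A * Sigs * Aᵀ = Sigt ∧ A * Sigs * A = Sigt := by
  subst hS2
  have hSu : IsUnit S := isUnit_of_mul_isUnit_left hSigs.isUnit
  have hRu : IsUnit R :=
    isUnit_of_mul_isUnit_left (hR2 ▸ (hSu.mul hSigt.isUnit).mul hSu)
  have hSdet : IsUnit S.det := (isUnit_iff_isUnit_det S).mp hSu
  have hSinv : IsUnit S⁻¹ := (isUnit_nonsing_inv_iff).mpr hSu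
  have hApsd : A.PosSemidef := by
    have h := hR.mul_mul_conjTranspose_same S⁻¹
    rwa [hS.inv.isHermitian.eq, ← hA] at h
  have hAu : IsUnit A := hA ▸ (hSinv.mul hRu).mul hSinv
  have hAt : Aᵀ = A := by
    rw [← conjTranspose_eq_transpose_of_trivial, hApsd.isHermitian.eq]
  have hmap : A * (S * S) * A = Sigt := by
    calc A * (S * S) * A
        = S⁻¹ * R * (S⁻¹ * S) * (S * S⁻¹) * R * S⁻¹ := by
          simp only [hA, Matrix.mul_assoc]
      _ = S⁻¹ * (R * R) * S⁻¹ := by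
          rw [nonsing_inv_mul S hSdet, mul_nonsing_inv S hSdet]
          simp only [Matrix.mul_one, Matrix.mul_assoc]
      _ = (S⁻¹ * S) * Sigt * (S * S⁻¹) := by
          simp only [hR2, Matrix.mul_assoc]
      _ = Sigt := by
          rw [nonsing_inv_mul S hSdet, mul_nonsing_inv S hSdet, Matrix.one_mul, Matrix.mul_one]
  exact ⟨hApsd.posDef_iff_isUnit.mpr hAu, by rw [hAt, hmap], hmap⟩
end
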